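/- arXiv:2405.03629 — 2 statements merged into one kernel-verified Lean document; each statement's English description precedes it below -/
import Mathlib

section
/- Assume the vertex representation: for every y ∈ ℝ^m with E y ≤ 0, X(y) equals the convex hull of {V_1 y, …, V_v y}. If (y, u, y) ∈ 𝕊 for some u ∈ ℝ^{v·nu}, then X(y) is a robust control invariant set: for every x ∈ X(y) there exists an input u_x ∈ 𝒰 such that A x + B u_x + w ∈ X(y) for every (A,B) ∈ Δ and every w ∈ 𝒲. -/
open Matrix

/-- The constraint set `𝕊` of tube parameters `(y, u, y⁺)`. -/
def Sset {n nu m p v q : ℕ}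
    (A : Fin p → Matrix (Fin n) (Fin n) ℝ)
    (B : Fin p → Matrix (Fin n) (Fin nu) ℝ)
    (SX : Set (Fin n → ℝ)) (SU : Set (Fin nu → ℝ))
    (F : Matrix (Fin m) (Fin n) ℝ)
    (E : Matrix (Fin q) (Fin m) ℝ)
    (V : Fin v → Matrix (Fin n) (Fin m) ℝ)
    (U : Fin v → Matrix (Fin nu) (Fin (v * nu)) ℝ)
    (d : Fin m → ℝ) :
    Set ((Fin m → ℝ) × (Fin (v * nu) → ℝ) × (Fin m → ℝ)) :=
  {s | (∀ (i : Fin p) (j : Fin v),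
        F.mulVec ((A i).mulVec ((V j).mulVec s.1) + (B i).mulVec ((U j).mulVec s.2.1)) + d
          ≤ s.2.2)
    ∧ E.mulVec s.1 ≤ 0
    ∧ (∀ j : Fin v, (V j).mulVec s.1 ∈ SX)
    ∧ (∀ j : Fin v, (U j).mulVec s.2.1 ∈ SU)}

/-- The multiplicative-uncertainty set `Δ = convh {(A₁,B₁),…,(A_p,B_p)}`. -/
def Delta {n nu p : ℕ}
    (A : Fin p → Matrix (Fin n) (Fin n) ℝ)
    (B : Fin p → Matrix (Fin n) (Fin nu) ℝ) :
    Set (Matrix (Fin n) (Fin n) ℝ × Matrix (Fin n) (Fin nu) ℝ) :=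
  {AB | ∃ θ : Fin p → ℝ, (∀ i, 0 ≤ θ i) ∧ (∑ i, θ i) = 1 ∧
    AB.1 = ∑ i, θ i • A i ∧ AB.2 = ∑ i, θ i • B i}

/-- The parametric polytope `X(y) = {x : F x ≤ y}`. -/
def Xset {n m : ℕ} (F : Matrix (Fin m) (Fin n) ℝ) (y : Fin m → ℝ) : Set (Fin n → ℝ) :=
  {x | F.mulVec x ≤ y}

theorem convex_Xset {n m : ℕ} (F : Matrix (Fin m) (Fin n) ℝ) (y : Fin m → ℝ) :
    Convex ℝ (Xset F y) :=
  (convex_Iic y).linear_preimage F.mulVecLin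

/-- The states for which one admissible input steers all vertex systems into a convex set form a
convex set. -/
theorem convex_setOf_exists_common_input {n nu : ℕ} {ι : Type*}
    (A : ι → Matrix (Fin n) (Fin n) ℝ) (B : ι → Matrix (Fin n) (Fin nu) ℝ)
    {SU : Set (Fin nu → ℝ)} (hSU : Convex ℝ SU) {K : Set (Fin n → ℝ)} (hK : Convex ℝ K) :
    Convex ℝ {x | ∃ ux ∈ SU, ∀ i, (A i).mulVec x + (B i).mulVec ux ∈ K} := by
  rintro x₁ ⟨u₁, hu₁, h₁⟩ x₂ ⟨u₂, hu₂, h₂⟩ a b ha hb hab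
  refine ⟨a • u₁ + b • u₂, hSU hu₁ hu₂ ha hb hab, fun i => ?_⟩
  convert hK (h₁ i) (h₂ i) ha hb hab using 1
  simp only [mulVec_add, mulVec_smul, smul_add]
  abel

/-- If all vertex systems map `(x, ux)` into a convex set, so does every system in `Delta`. -/
theorem mulVec_add_mulVec_mem_of_mem_Delta {n nu p : ℕ}
    {A : Fin p → Matrix (Fin n) (Fin n) ℝ} {B : Fin p → Matrix (Fin n) (Fin nu) ℝ}
    {K : Set (Fin n → ℝ)} (hK : Convex ℝ K) {x : Fin n → ℝ} {ux : Fin nu → ℝ}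
    (h : ∀ i, (A i).mulVec x + (B i).mulVec ux ∈ K)
    {AB : Matrix (Fin n) (Fin n) ℝ × Matrix (Fin n) (Fin nu) ℝ} (hAB : AB ∈ Delta A B) :
    AB.1.mulVec x + AB.2.mulVec ux ∈ K := by
  obtain ⟨θ, hθ, hsum, hA, hB⟩ := hAB
  convert hK.sum_mem (fun i _ => hθ i) hsum (fun i _ => h i) using 1
  simp only [hA, hB, sum_mulVec, smul_mulVec, smul_add, Finset.sum_add_distrib]

/-- Under the vertex representation, if `(y, u, y) ∈ 𝕊` for some vertex inputs
`u`, then `X(y)` is a robust control invariant set. -/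
theorem configuration_constrained_RCI
    {n nu m p v q : ℕ}
    (A : Fin p → Matrix (Fin n) (Fin n) ℝ)
    (B : Fin p → Matrix (Fin n) (Fin nu) ℝ)
    (W SX : Set (Fin n → ℝ)) (SU : Set (Fin nu → ℝ))
    (hW : Convex ℝ W) (hSX : Convex ℝ SX) (hSU : Convex ℝ SU)
    (F : Matrix (Fin m) (Fin n) ℝ)
    (E : Matrix (Fin q) (Fin m) ℝ)
    (V : Fin v → Matrix (Fin n) (Fin m) ℝ)
    (U : Fin v → Matrix (Fin nu) (Fin (v * nu)) ℝ)
    (d : Fin m → ℝ)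
    (hd : ∀ w ∈ W, F.mulVec w ≤ d)
    (hvert : ∀ y : Fin m → ℝ, E.mulVec y ≤ 0 →
      Xset F y = convexHull ℝ (Set.range fun j : Fin v => (V j).mulVec y))
    (y : Fin m → ℝ)
    (hy : ∃ u : Fin (v * nu) → ℝ, (y, u, y) ∈ Sset A B SX SU F E V U d) :
    ∀ x ∈ Xset F y, ∃ ux ∈ SU,
      ∀ AB ∈ Delta A B, ∀ w ∈ W,
        AB.1.mulVec x + AB.2.mulVec ux + w ∈ Xset F y := by
  obtain ⟨u, hstep, hE, -, hU⟩ := hy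
  have hK : Convex ℝ (Xset F (y - d)) := convex_Xset F (y - d)
  intro x hx
  rw [hvert y hE] at hx
  have hvertices : (Set.range fun j : Fin v => (V j).mulVec y) ⊆
      {x | ∃ ux ∈ SU, ∀ i, (A i).mulVec x + (B i).mulVec ux ∈ Xset F (y - d)} :=
    Set.range_subset_iff.2 fun j =>
      ⟨(U j).mulVec u, hU j, fun i => le_sub_iff_add_le.2 (hstep i j)⟩
  obtain ⟨ux, hux, hxu⟩ :=
    convexHull_min hvertices (convex_setOf_exists_common_input A B hSU hK) hx
  refine ⟨ux, hux, fun AB hAB w hw => ?_⟩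
  have hmem : F.mulVec (AB.1.mulVec x + AB.2.mulVec ux) ≤ y - d :=
    mulVec_add_mulVec_mem_of_mem_Delta hK hxu hAB
  change F.mulVec (AB.1.mulVec x + AB.2.mulVec ux + w) ≤ y
  rw [mulVec_add]
  exact (add_le_add hmem (hd w hw)).trans_eq (sub_add_cancel y d)
end

section
/- (Core estimate in the proof of Theorem 1.) Let γ ∈ [0,1] and let Q and P be symmetric positive-semidefinite (m + v·nu)×(m + v·nu) real matrices with zᵀ Q z + γ² · zᵀ P z ≤ zᵀ P z for all z ∈ ℝ^{m + v·nu}. Suppose (y_s, u_s, y_s) ∈ 𝕊 and (ȳ, ū, γ·ȳ + (1−γ)·y_s) ∈ 𝕊, and set ȳ⁺ := γ·ȳ + (1−γ)·y_s. Then M(ȳ⁺, y_s, u_s) + V(ȳ, ȳ⁺, y_s, u_s) ≤ ‖(ȳ − y_s, ū − u_s)‖_P². -/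
open Matrix
open scoped ENNReal

/-- Terminal cost `M(y, y_s, u_s)`, an infimum taken in `[0, +∞]` (equal to `+∞` when the
feasible set is empty). -/
noncomputable def Mterm {m k : ℕ} (γ : ℝ)
    (S : Set ((Fin m → ℝ) × (Fin k → ℝ) × (Fin m → ℝ)))
    (P : Matrix (Fin m ⊕ Fin k) (Fin m ⊕ Fin k) ℝ)
    (y ys : Fin m → ℝ) (us : Fin k → ℝ) : ℝ≥0∞ :=
  ⨅ (u : Fin k → ℝ) (_ : (y, u, γ • y + (1 - γ) • ys) ∈ S),
    ENNReal.ofReal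
      (Sum.elim (y - ys) (u - us) ⬝ᵥ P.mulVec (Sum.elim (y - ys) (u - us)))

/-- Cost-to-travel `V(y, y⁺, y_s, u_s)`, an infimum taken in `[0, +∞]` (equal to `+∞` when the
feasible set is empty). -/
noncomputable def Vtravel {m k : ℕ}
    (S : Set ((Fin m → ℝ) × (Fin k → ℝ) × (Fin m → ℝ)))
    (Q : Matrix (Fin m ⊕ Fin k) (Fin m ⊕ Fin k) ℝ)
    (y yp ys : Fin m → ℝ) (us : Fin k → ℝ) : ℝ≥0∞ :=
  ⨅ (u : Fin k → ℝ) (_ : (y, u, yp) ∈ S),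
    ENNReal.ofReal
      (Sum.elim (y - ys) (u - us) ⬝ᵥ Q.mulVec (Sum.elim (y - ys) (u - us)))

/-- The constraint set `𝕊` is convex when the state and input constraint sets are. -/
theorem convex_Sset {n nu m p v q : ℕ}
    (A : Fin p → Matrix (Fin n) (Fin n) ℝ)
    (B : Fin p → Matrix (Fin n) (Fin nu) ℝ)
    {SX : Set (Fin n → ℝ)} {SU : Set (Fin nu → ℝ)}
    (hSX : Convex ℝ SX) (hSU : Convex ℝ SU)
    (F : Matrix (Fin m) (Fin n) ℝ)
    (E : Matrix (Fin q) (Fin m) ℝ)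
    (V : Fin v → Matrix (Fin n) (Fin m) ℝ)
    (U : Fin v → Matrix (Fin nu) (Fin (v * nu)) ℝ)
    (d : Fin m → ℝ) :
    Convex ℝ (Sset A B SX SU F E V U d) := by
  rintro ⟨y, u, y'⟩ ⟨hdyn, hE, hX, hU⟩ ⟨z, w, z'⟩ ⟨hdyn', hE', hX', hU'⟩ a b ha hb hab
  refine ⟨fun i j => ?_, ?_, fun j => ?_, fun j => ?_⟩
  · have h := add_le_add (smul_le_smul_of_nonneg_left (hdyn i j) ha)
      (smul_le_smul_of_nonneg_left (hdyn' i j) hb)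
    refine le_of_eq_of_le ?_ h
    have hd : d = a • d + b • d := by rw [← add_smul, hab, one_smul]
    conv_lhs => rw [hd]
    simp only [Prod.fst_add, Prod.snd_add, Prod.smul_fst, Prod.smul_snd, mulVec_add,
      mulVec_smul, smul_add]
    abel
  · have h := add_le_add (smul_le_smul_of_nonneg_left hE ha)
      (smul_le_smul_of_nonneg_left hE' hb)
    simpa [mulVec_add, mulVec_smul] using h
  · simpa [mulVec_add, mulVec_smul] using hSX (hX j) (hX' j) ha hb hab
  · simpa [mulVec_add, mulVec_smul] using hSU (hU j) (hU' j) ha hb hab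

/-- **core estimate of Theorem 1.** Under `Q + γ²P ⪯ P` (as quadratic forms) and
the stated feasibility conditions, with `ȳ⁺ = γȳ + (1−γ)y_s`:
`M(ȳ⁺, y_s, u_s) + V(ȳ, ȳ⁺, y_s, u_s) ≤ ‖(ȳ − y_s, ū − u_s)‖_P²`. -/
theorem Mterm_add_Vtravel_le
    {n nu m p v q : ℕ}
    (A : Fin p → Matrix (Fin n) (Fin n) ℝ)
    (B : Fin p → Matrix (Fin n) (Fin nu) ℝ)
    (W SX : Set (Fin n → ℝ)) (SU : Set (Fin nu → ℝ))
    (hW : Convex ℝ W) (hSX : Convex ℝ SX) (hSU : Convex ℝ SU)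
    (F : Matrix (Fin m) (Fin n) ℝ)
    (E : Matrix (Fin q) (Fin m) ℝ)
    (V : Fin v → Matrix (Fin n) (Fin m) ℝ)
    (U : Fin v → Matrix (Fin nu) (Fin (v * nu)) ℝ)
    (d : Fin m → ℝ)
    (hd : ∀ w ∈ W, F.mulVec w ≤ d)
    (γ : ℝ) (hγ0 : 0 ≤ γ) (hγ1 : γ ≤ 1)
    (Q P : Matrix (Fin m ⊕ Fin (v * nu)) (Fin m ⊕ Fin (v * nu)) ℝ)
    (hQsymm : Q.IsSymm) (hPsymm : P.IsSymm)
    (hQpsd : ∀ z : Fin m ⊕ Fin (v * nu) → ℝ, 0 ≤ z ⬝ᵥ Q.mulVec z)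
    (hPpsd : ∀ z : Fin m ⊕ Fin (v * nu) → ℝ, 0 ≤ z ⬝ᵥ P.mulVec z)
    (hQP : ∀ z : Fin m ⊕ Fin (v * nu) → ℝ,
      z ⬝ᵥ Q.mulVec z + γ ^ 2 * (z ⬝ᵥ P.mulVec z) ≤ z ⬝ᵥ P.mulVec z)
    (ys : Fin m → ℝ) (us : Fin (v * nu) → ℝ)
    (hys : (ys, us, ys) ∈ Sset A B SX SU F E V U d)
    (yb : Fin m → ℝ) (ub : Fin (v * nu) → ℝ)
    (hyb : (yb, ub, γ • yb + (1 - γ) • ys) ∈ Sset A B SX SU F E V U d) :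
    Mterm γ (Sset A B SX SU F E V U d) P (γ • yb + (1 - γ) • ys) ys us
      + Vtravel (Sset A B SX SU F E V U d) Q yb (γ • yb + (1 - γ) • ys) ys us
      ≤ ENNReal.ofReal
          (Sum.elim (yb - ys) (ub - us) ⬝ᵥ P.mulVec (Sum.elim (yb - ys) (ub - us))) := by
  set z := Sum.elim (yb - ys) (ub - us) with hz
  have hmem : (γ • yb + (1 - γ) • ys, γ • ub + (1 - γ) • us,
      γ • (γ • yb + (1 - γ) • ys) + (1 - γ) • ys) ∈ Sset A B SX SU F E V U d :=
    convex_Sset A B hSX hSU F E V U d hyb hys hγ0 (sub_nonneg.2 hγ1) (add_sub_cancel γ 1)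
  have hscale : Sum.elim (γ • yb + (1 - γ) • ys - ys) (γ • ub + (1 - γ) • us - us) = γ • z := by
    ext (i | i) <;> simp [hz] <;> ring
  have hM : Mterm γ (Sset A B SX SU F E V U d) P (γ • yb + (1 - γ) • ys) ys us
      ≤ ENNReal.ofReal (γ ^ 2 * (z ⬝ᵥ P.mulVec z)) := by
    unfold Mterm
    refine (iInf₂_le (γ • ub + (1 - γ) • us) hmem).trans_eq ?_
    rw [hscale, mulVec_smul, smul_dotProduct, dotProduct_smul, smul_eq_mul, smul_eq_mul,
      ← mul_assoc, ← sq]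
  have hV : Vtravel (Sset A B SX SU F E V U d) Q yb (γ • yb + (1 - γ) • ys) ys us
      ≤ ENNReal.ofReal (z ⬝ᵥ Q.mulVec z) := by
    unfold Vtravel
    exact iInf₂_le ub hyb
  refine (add_le_add hM hV).trans ?_
  rw [← ENNReal.ofReal_add (mul_nonneg (sq_nonneg γ) (hPpsd z)) (hQpsd z), add_comm]
  exact ENNReal.ofReal_le_ofReal (hQP z)
end
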